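/- Let a ∈ C_c^∞(T*𝕋^d) with Fourier expansion a(x,ξ) = Σ_{k∈ℤ^d} a_k(ξ)ψ_k(x) and with ∫_{𝕋^d} a(x,·)dx = 0 (i.e. a_0 ≡ 0), and let φ ∈ S(ℝ). Then there exists a constant C_{a,φ} > 0 such that for every u ∈ L²(𝕋^d) and every h > 0, | ∫_ℝ φ(t) ⟨w_u^h(t,·), a⟩ dt − Σ_{ω∈𝕎} tr ∫_{I_ω} k_{a,φ}(ω,ξ) R_u^h(ω,dξ) | ≤ C_{a,φ} ‖u‖²_{L²(𝕋^d)} h. -/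

import Mathlib

/-!
Setting (F. Macià, "High-frequency propagation for the Schrödinger equation on
the torus").

The flat torus `𝕋^d = ℝ^d/(2πℤ)^d` is modelled as `Fin d → AddCircle (2π)`; an
element `u ∈ L²(𝕋^d)` is represented by its sequence of Fourier coefficients
`û : ℤ^d → ℂ` (with respect to the orthonormal basis `ψ_k = (2π)^{-d/2} e^{ik·x}`),
and operators on `L²(γ_ω)` by their kernels (matrices) in the orthonormal basis
`φ_m^ω(s) = e^{ims/|p_ω|}/√(2π|p_ω|)`, `m ∈ ℤ`.
-/

noncomputable section

open MeasureTheory Filter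
open scoped BigOperators ComplexConjugate Topology ENNReal

namespace TorusSchrodinger

instance fact_two_pi_pos : Fact (0 < 2 * Real.pi) := ⟨by positivity⟩

/-- The lattice `ℤ^d` of Fourier frequencies. -/
abbrev Zd (d : ℕ) := Fin d → ℤ
/-- Euclidean space `ℝ^d` (the fibre of `T^*𝕋^d`). -/
abbrev Rd (d : ℕ) := Fin d → ℝ
/-- The standard flat torus `𝕋^d = ℝ^d/(2πℤ)^d`. -/
abbrev Td (d : ℕ) := Fin d → AddCircle (2 * Real.pi)
/-- The phase space `T^*𝕋^d ≅ 𝕋^d × ℝ^d`. -/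
abbrev Phase (d : ℕ) := Td d × Rd d

variable {d : ℕ}

/-- Inclusion of the lattice `ℤ^d` into `ℝ^d`. -/
def toRd (k : Zd d) : Rd d := fun i => (k i : ℝ)

/-- The canonical projection `ℝ^d → 𝕋^d`. -/
def torusProj (x : Rd d) : Td d := fun i => (x i : AddCircle (2 * Real.pi))

/-- The character `e^{i k·x}` on the torus `𝕋^d`. -/
def char (k : Zd d) (x : Td d) : ℂ := ∏ i, fourier (k i) (x i)

/-- Euclidean inner product of two lattice vectors. -/
def dotZ (k l : Zd d) : ℤ := ∑ i, k i * l i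

/-- Euclidean inner product of a lattice vector with a vector of `ℝ^d`. -/
def dotR (k : Zd d) (ξ : Rd d) : ℝ := ∑ i, (k i : ℝ) * ξ i

/-- The set `Ω` of resonant frequencies in `ℝ^d`. -/
def Omega (d : ℕ) : Set (Rd d) := {ξ | ∃ k : Zd d, k ≠ 0 ∧ dotR k ξ = 0}

/-- A resonant direction `ω ∈ 𝕎`, encoded by its primitive lattice vector `p_ω`:
the nonzero components of `p_ω` are coprime and its first nonzero component is
positive. -/
structure ResonantDir (d : ℕ) where
  p : Zd d
  ne : p ≠ 0
  gcd_one : Finset.univ.gcd (fun i => (p i).natAbs) = 1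
  first_pos : ∀ i, (∀ j, j < i → p j = 0) → 0 ≤ p i

/-- `|p_ω|²`, as an integer. -/
def ResonantDir.M (ω : ResonantDir d) : ℤ := dotZ ω.p ω.p

/-- Orthogonal projection of a lattice point onto the hyperplane `I_ω`. -/
def projPerp (ω : ResonantDir d) (k : Zd d) : Rd d :=
  toRd k - (((dotZ k ω.p : ℝ) / (ω.M : ℝ)) • toRd ω.p)

/-- The set `ω_n^⊥ ⊆ I_ω`: those `r` in the hyperplane `I_ω` with
`(n/|p_ω|)ν_ω + r ∈ ℤ^d` (note `(n/|p_ω|)ν_ω = (n/|p_ω|²) p_ω`). -/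
def perpSet (ω : ResonantDir d) (n : ℤ) : Set (Rd d) :=
  {r | dotR ω.p r = 0 ∧ ∃ k : Zd d, toRd k = ((n : ℝ) / (ω.M : ℝ)) • toRd ω.p + r}

/-! Kernels: operators on `L²(γ_ω)` are represented by their matrix in the
orthonormal basis `(φ_m^ω)_{m ∈ ℤ}`. -/

/-- Kernels of Hermitian operators. -/
def KerHermitian (K : ℤ → ℤ → ℂ) : Prop := ∀ m n, K n m = conj (K m n)

/-- Positive (semidefinite) kernels: the quadratic form is nonnegative on all
finitely supported vectors. -/
def KerPos (K : ℤ → ℤ → ℂ) : Prop :=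
  ∀ v : ℤ →₀ ℂ, 0 ≤ (∑ m ∈ v.support, ∑ n ∈ v.support, conj (v m) * K m n * v n).re

/-- Hilbert–Schmidt kernels. -/
def IsHSKer (K : ℤ → ℤ → ℂ) : Prop := Summable fun q : ℤ × ℤ => ‖K q.1 q.2‖ ^ 2

/-- Trace class kernels: products of two Hilbert–Schmidt kernels. -/
def IsTraceClassKer (K : ℤ → ℤ → ℂ) : Prop :=
  ∃ A B : ℤ → ℤ → ℂ, IsHSKer A ∧ IsHSKer B ∧ ∀ m n, K m n = ∑' j : ℤ, A m j * B j n

/-- Kernels of operators of operator norm at most 1. -/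
def KerContraction (C : ℤ → ℤ → ℂ) : Prop :=
  ∀ v : ℤ →₀ ℂ, ∑' m : ℤ, ‖∑ n ∈ v.support, C m n * v n‖ ^ 2 ≤ ∑ n ∈ v.support, ‖v n‖ ^ 2

/-- The trace norm `tr|K|` of a kernel, via duality with contractions. -/
def traceNorm (K : ℤ → ℤ → ℂ) : ℝ :=
  ⨆ C : {C : ℤ → ℤ → ℂ // KerContraction C}, ‖∑' q : ℤ × ℤ, K q.1 q.2 * C.1 q.2 q.1‖

/-- Truncation of a kernel to the square `[-N,N]²`. -/
def kerTrunc (N : ℕ) (C : ℤ → ℤ → ℂ) : ℤ → ℤ → ℂ := fun m n =>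
  if m.natAbs ≤ N ∧ n.natAbs ≤ N then C m n else 0

/-- The operator norm of a kernel. -/
def kerOpNorm (C : ℤ → ℤ → ℂ) : ℝ :=
  ⨆ v : {v : ℤ →₀ ℂ // ∑ n ∈ v.support, ‖v n‖ ^ 2 ≤ 1},
    Real.sqrt (∑' m : ℤ, ‖∑ n ∈ v.1.support, C m n * v.1 n‖ ^ 2)

/-- Kernels of compact operators: operator-norm limits of their finite truncations. -/
def KerCompact (C : ℤ → ℤ → ℂ) : Prop :=
  Tendsto (fun N : ℕ => kerOpNorm fun m n => C m n - kerTrunc N C m n) atTop (𝓝 0)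

/-! Wigner distributions. -/

/-- Fourier coefficients of the solution at time `t` of the Schrödinger equation
`i∂_t u + (1/2)Δu = 0` on `𝕋^d` in terms of those of the initial datum. -/
def schrodinger (t : ℝ) (u : Zd d → ℂ) : Zd d → ℂ := fun k =>
  Complex.exp (-Complex.I * (t : ℂ) * (((∑ i, ((k i : ℝ)) ^ 2 : ℝ)) : ℂ) / 2) * u k

/-- The pairing `⟨w_u^h, a⟩` of the Wigner distribution at scale `h` of (the
function with Fourier coefficients) `u` with a symbol `a` on `T^*𝕋^d`. -/
def wignerPair (u : Zd d → ℂ) (h : ℝ) (a : Phase d → ℂ) : ℂ :=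
  (((2 * Real.pi) ^ d : ℝ) : ℂ)⁻¹ *
    ∑' q : Zd d × Zd d,
      u q.1 * conj (u q.2) *
        ∫ x : Td d, a (x, (h / 2) • (toRd q.1 + toRd q.2)) * char (q.1 - q.2) x

/-- Test symbols `a ∈ C_c^∞(T^*𝕋^d)`. -/
def IsSymbol (a : Phase d → ℂ) : Prop :=
  Continuous a ∧ HasCompactSupport a ∧
    ContDiff ℝ (⊤ : ℕ∞) fun q : Rd d × Rd d => a (torusProj q.1, q.2)

/-- A sequence of data `(u_h)` in `L²(𝕋^d)` (given by their Fourier coefficients),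
bounded in `L²`, with scales `h → 0⁺`. -/
structure WignerData (d : ℕ) where
  h : ℕ → ℝ
  u : ℕ → Zd d → ℂ
  h_pos : ∀ n, 0 < h n
  h_lim : Tendsto h atTop (𝓝 0)
  bounded : ∃ C : ℝ, ∀ n, ∑' k, ‖u n k‖ ^ 2 ≤ C

/-- Extraction of a subsequence. -/
def WignerData.sub (D : WignerData d) (σ : ℕ → ℕ) (hσ : StrictMono σ) : WignerData d where
  h := D.h ∘ σ
  u := D.u ∘ σ
  h_pos n := D.h_pos (σ n)
  h_lim := D.h_lim.comp hσ.tendsto_atTop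
  bounded := D.bounded.imp fun _C hC n => hC (σ n)

/-- The `h`-oscillation property:
`limsup_{h→0⁺} ∑_{|k| > R/h} |û_h(k)|² → 0` as `R → ∞`. -/
def HOsc (D : WignerData d) : Prop :=
  Tendsto (fun R : ℝ =>
      limsup (fun n =>
        ∑' k : {k : Zd d // R ^ 2 < (∑ i, ((k i : ℝ)) ^ 2) * (D.h n) ^ 2}, ‖D.u n k.1‖ ^ 2)
        atTop)
    atTop (𝓝 0)

/-- `μ0` is the semiclassical (Wigner) measure of the sequence `(u_h)`:
`w_{u_h}^h(0,·) ⇀ μ0`. -/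
def IsSemiclassical (D : WignerData d) (μ0 : Measure (Phase d)) : Prop :=
  ∀ a : Phase d → ℂ, IsSymbol a →
    Tendsto (fun n => wignerPair (D.u n) (D.h n) a) atTop (𝓝 (∫ q, a q ∂μ0))

/-- `μ` is a time-averaged Wigner limit of the Schrödinger evolution of `(u_h)`. -/
def IsTimeAvgLimit (D : WignerData d) (μ : ℝ → Measure (Phase d)) : Prop :=
  ∀ a : Phase d → ℂ, IsSymbol a → ∀ φ : ℝ → ℂ, Integrable φ →
    Tendsto (fun n => ∫ t : ℝ, φ t * wignerPair (schrodinger t (D.u n)) (D.h n) a) atTop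
      (𝓝 (∫ t : ℝ, φ t * ∫ q, a q ∂(μ t)))

/-! The resonant Wigner distribution and resonant Wigner measures. -/

/-- The pairing `tr ∫ b(ξ) R_u^h(ω, dξ)` of the resonant Wigner distribution of `u`
at scale `h` in the resonant direction `ω` with an operator-valued test function
`b` (given by its kernel in the basis `(φ_m^ω)`).  The parametrisation
`k = (m/|p_ω|)ν_ω + r`, `j = (n/|p_ω|)ν_ω + r` (so `m = k·p_ω`, `n = j·p_ω`,
`r = projPerp ω k`) of pairs of frequencies with `k - j ∈ ℤ p_ω` is used. -/
def resPair (u : Zd d → ℂ) (h : ℝ) (ω : ResonantDir d) (b : Rd d → ℤ → ℤ → ℂ) : ℂ :=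
  ∑' q : {q : Zd d × Zd d // ∃ l : ℤ, q.1 - q.2 = l • ω.p},
    u q.1.1 * conj (u q.1.2) * b (h • projPerp ω q.1.1) (dotZ q.1.2 ω.p) (dotZ q.1.1 ω.p)

/-- A positive finite measure on `ℝ^d` with values in the trace-class operators on
`L²(γ_ω)`, represented (via the Radon–Nikodym theorem for operator-valued
measures) by its scalar trace measure `trMeas` and a measurable field `dens` of
positive Hermitian density matrices of unit trace (in the basis `(φ_m^ω)`). -/
structure OpMeasure (d : ℕ) where
  trMeas : Measure (Rd d)
  finite : IsFiniteMeasure trMeas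
  dens : Rd d → ℤ → ℤ → ℂ
  meas : ∀ m n, Measurable fun ξ => dens ξ m n
  herm : ∀ ξ m n, dens ξ n m = conj (dens ξ m n)
  pos : ∀ ξ, KerPos (dens ξ)
  normalized : ∀ ξ, HasSum (fun m : ℤ => dens ξ m m) 1

/-- The pairing `tr ∫ b(ξ) μ(dξ)` of an operator-valued measure with an
operator-valued test function. -/
def OpMeasure.trPair (M : OpMeasure d) (b : Rd d → ℤ → ℤ → ℂ) : ℂ :=
  ∫ ξ, (∑' q : ℤ × ℤ, b ξ q.2 q.1 * M.dens ξ q.1 q.2) ∂M.trMeas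

/-- Test sections `b ∈ C_c(I_ω; K(L²(γ_ω)))`: continuous, compactly supported,
compact-operator-valued. -/
def IsOpTestField (b : Rd d → ℤ → ℤ → ℂ) : Prop :=
  Continuous b ∧ HasCompactSupport b ∧ ∀ ξ : Rd d, KerCompact (b ξ)

/-- `μR` is a resonant Wigner measure of the sequence `(u_h)`: for every resonant
direction `ω` it is a positive trace-class-operator-valued measure concentrated
on `I_ω` whose matrix entries `(m,n)` vanish unless `m ≡ n (mod |p_ω|²)`, and
`tr ∫ b dR_{u_h}^h(ω,·) → tr ∫ b dμR(ω,·)` for all test sections `b`. -/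
def IsResonantWignerMeasure (D : WignerData d) (μR : ResonantDir d → OpMeasure d) : Prop :=
  ∀ ω : ResonantDir d,
    (μR ω).trMeas {ξ | dotR ω.p ξ ≠ 0} = 0 ∧
    (∀ (ξ : Rd d) (m n : ℤ), ¬ (ω.M ∣ (m - n)) → (μR ω).dens ξ m n = 0) ∧
    ∀ b : Rd d → ℤ → ℤ → ℂ, IsOpTestField b →
      Tendsto (fun n => resPair (D.u n) (D.h n) ω b) atTop (𝓝 ((μR ω).trPair b))

/-- The density matrix of `μ_R^t(ω,·) = e^{it∂_ω²/2} μ_R⁰(ω,·) e^{-it∂_ω²/2}`, the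
solution of the density-matrix Schrödinger equation
`i∂_t μ_R^t = [-(1/2)∂_ω², μ_R^t]` on `γ_ω` with initial datum `μ_R⁰`. -/
def densT (M : OpMeasure d) (ω : ResonantDir d) (t : ℝ) (ξ : Rd d) (m n : ℤ) : ℂ :=
  Complex.exp (-Complex.I * (t : ℂ) * ((((m ^ 2 - n ^ 2 : ℤ) : ℝ) / (2 * (ω.M : ℝ)) : ℝ) : ℂ)) *
    M.dens ξ m n

/-- The geodesic flow `φ_s(x,ξ) = (x + sξ, ξ)` on `T^*𝕋^d`. -/
def geoFlow (s : ℝ) (q : Phase d) : Phase d := (q.1 + torusProj (s • q.2), q.2)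

/-- `g` is (a density of) the signed measure
`ρ_ω^t = E_ω(ρ̃_ω^t(·,ξ) − (2π|p_ω|)⁻¹ (tr μ_R^t(ω,ξ)) ds)` on `𝕋^d × I_ω`, where
`ρ̃_ω^t` is the trace density of `μ_R^t(ω,·)` and `E_ω` the extension operator:
`g` is characterised by its Fourier coefficients in `x`, which are supported on
the frequencies `l p_ω`, `l ≠ 0`, and are given there by the corresponding
traces `∑_{m-n=l|p_ω|²} μ_R^t(ω,·)(m,n)` of the propagated measure. -/
def IsRhoDensity (M : OpMeasure d) (ω : ResonantDir d) (t : ℝ) (g : Phase d → ℝ) : Prop :=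
  Integrable g ((volume : Measure (Td d)).prod M.trMeas) ∧
  (∀ l : ℤ, l ≠ 0 → ∀ φ : Rd d → ℂ, Continuous φ → HasCompactSupport φ →
    ∫ q : Phase d, char (l • ω.p) q.1 * φ q.2 * ((g q : ℝ) : ℂ)
        ∂((volume : Measure (Td d)).prod M.trMeas)
      = ∫ ξ : Rd d, φ ξ * ∑' n : ℤ, densT M ω t ξ (n - l * ω.M) n ∂M.trMeas) ∧
  (∀ k : Zd d, (¬ ∃ l : ℤ, l ≠ 0 ∧ k = l • ω.p) → ∀ φ : Rd d → ℂ, Continuous φ →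
    HasCompactSupport φ →
    ∫ q : Phase d, char k q.1 * φ q.2 * ((g q : ℝ) : ℂ)
        ∂((volume : Measure (Td d)).prod M.trMeas) = 0)

/-- The signed measure `ρ_ω^t` on `T^*𝕋^d` associated to a density `g` (with
respect to `dx ⊗ tr μ_R(ω,·)`). -/
def rhoMeas (M : OpMeasure d) (g : Phase d → ℝ) : SignedMeasure (Phase d) :=
  ((volume : Measure (Td d)).prod M.trMeas).withDensityᵥ g

/-! Symbols, `k_{a,φ}`, `K_b`, position densities, wave packets. -/

/-- The `k`-th Fourier coefficient in `x` of a symbol `a(x,ξ)` on `T^*𝕋^d`: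
`a_k(ξ) = ∫_{𝕋^d} a(x,ξ) conj(ψ_k(x)) dx`. -/
def symbCoeff (a : Phase d → ℂ) (k : Zd d) (ξ : Rd d) : ℂ :=
  ((Real.sqrt ((2 * Real.pi) ^ d) : ℝ) : ℂ)⁻¹ * ∫ x : Td d, a (x, ξ) * conj (char k x)

/-- The Fourier transform `φ̂(s) = ∫ φ(t) e^{-its} dt`. -/
def phiHat (φ : ℝ → ℂ) (s : ℝ) : ℂ :=
  ∫ t : ℝ, φ t * Complex.exp (-Complex.I * (t : ℂ) * (s : ℂ))

/-- The kernel (in the basis `(φ_m^ω)`) of the operator `k_{a,φ}(ω,ξ)` on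
`L²(γ_ω)`. -/
def kerKaphi (a : Phase d → ℂ) (φ : ℝ → ℂ) (ω : ResonantDir d) (ξ : Rd d) (m n : ℤ) : ℂ :=
  if m ≠ n ∧ ω.M ∣ (m - n) then
    ((Real.sqrt ((2 * Real.pi) ^ d) : ℝ) : ℂ)⁻¹ *
      phiHat φ (((n ^ 2 - m ^ 2 : ℤ) : ℝ) / (2 * (ω.M : ℝ))) *
      symbCoeff a (((m - n) / ω.M) • ω.p) ξ
  else 0

/-- The kernel (in the basis `(φ_m^ω)`) of the operator
`K_b = ∫_{I_ω} b(ξ) R_u^h(ω,dξ)` on `L²(γ_ω)`: for `m ≡ n (mod |p_ω|²)`,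
`k_b(m,n) = ∑_{r ∈ ω_c^⊥} b(hr) û((m/|p_ω|)ν_ω+r) conj(û((n/|p_ω|)ν_ω+r))`, using
the parametrisation of `ω_m^⊥` by `{k ∈ ℤ^d : k·p_ω = m}`. -/
def kerKb (u : Zd d → ℂ) (h : ℝ) (ω : ResonantDir d) (b : Rd d → ℂ) (m n : ℤ) : ℂ :=
  if ω.M ∣ (n - m) then
    ∑' k : {k : Zd d // dotZ k ω.p = m},
      b (h • projPerp ω k.1) * u k.1 * conj (u (k.1 + ((n - m) / ω.M) • ω.p))
  else 0

/-- The pairing `∫_{𝕋^d} m(x) |u(x)|² dx` of a position density with a test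
function `m`. -/
def posDenPair (u : Zd d → ℂ) (m : Td d → ℂ) : ℂ :=
  (((2 * Real.pi) ^ d : ℝ) : ℂ)⁻¹ *
    ∑' q : Zd d × Zd d, u q.1 * conj (u q.2) * ∫ x : Td d, m x * char (q.1 - q.2) x

/-- Fourier coefficients of the `2πℤ^d`-periodisation of the wave packet
`h^{-d/4} ρ((x-x₀)/√h) e^{iξ₀·x/h}` (for `ρ` supported in `(-π,π)^d`). -/
def wavePacket (ρ : Rd d → ℂ) (x₀ ξ₀ : Rd d) (h : ℝ) (k : Zd d) : ℂ :=
  ((Real.sqrt ((2 * Real.pi) ^ d) : ℝ) : ℂ)⁻¹ *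
    ∫ x : Rd d, ((h ^ (-(d : ℝ) / 4) : ℝ) : ℂ) * ρ (fun i => (x i - x₀ i) / Real.sqrt h) *
      Complex.exp (Complex.I * ((∑ i, (ξ₀ i / h - (k i : ℝ)) * x i : ℝ) : ℂ))

/-- Fourier coefficients of the `2πℤ^d`-periodisation of `ρ(x) e^{iξ₀·x/h}` (for
`ρ` supported in `(-π,π)^d`). -/
def oscData (ρ : Rd d → ℂ) (ξ₀ : Rd d) (h : ℝ) (k : Zd d) : ℂ :=
  ((Real.sqrt ((2 * Real.pi) ^ d) : ℝ) : ℂ)⁻¹ *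
    ∫ x : Rd d, ρ x * Complex.exp (Complex.I * ((∑ i, (ξ₀ i / h - (k i : ℝ)) * x i : ℝ) : ℂ))

/-- The solution `e^{itΔ/2} ρ_per` on `𝕋^d`, where `ρ_per` is the
`2πℤ^d`-periodisation of `ρ`. -/
def evolvedPer (ρ : Rd d → ℂ) (t : ℝ) (x : Td d) : ℂ :=
  ((Real.sqrt ((2 * Real.pi) ^ d) : ℝ) : ℂ)⁻¹ *
    ∑' k : Zd d,
      Complex.exp (-Complex.I * (t : ℂ) * ((∑ i, ((k i : ℝ)) ^ 2 : ℝ) : ℂ) / 2) *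
        oscData ρ 0 1 k * char k x

/-- Euclidean norm on `ℝ^d`. -/
def euclNorm (ξ : Rd d) : ℝ := Real.sqrt (∑ i, ξ i ^ 2)

/-- The length `L` of the periodic geodesic of `𝕋^d` issued from `(x, ξ₀)`: the
least `l > 0` such that `l·ξ₀/|ξ₀| ∈ 2πℤ^d`. -/
def geoLen (ξ₀ : Rd d) : ℝ :=
  sInf {l : ℝ | 0 < l ∧ ∃ k : Zd d, (l / euclNorm ξ₀) • ξ₀ = (2 * Real.pi) • toRd k}

/-- The average `⟨f⟩_{ξ₀}(x) = (|ξ₀|/L)∫_0^{L/|ξ₀|} f(x+sξ₀) ds` along the closed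
geodesic in the direction `ξ₀`. -/
def geoAvg (f : Td d → ℝ) (ξ₀ : Rd d) (x : Td d) : ℝ :=
  euclNorm ξ₀ / geoLen ξ₀ *
    ∫ s in Set.Ioc (0 : ℝ) (geoLen ξ₀ / euclNorm ξ₀), f (x + torusProj (s • ξ₀))

section SymbolClass

theorem torusProj_add (x y : Rd d) : torusProj (x + y) = torusProj x + torusProj y := by
  funext i; simp [torusProj]

theorem isOpenQuotientMap_torusProj : IsOpenQuotientMap (torusProj (d := d)) :=
  IsOpenQuotientMap.piMap (f := fun (_ : Fin d) (x : ℝ) => (x : AddCircle (2 * Real.pi)))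
    fun _ => QuotientAddGroup.isOpenQuotientMap_mk

theorem exists_torusProj_eq (x : Td d) : ∃ y : Rd d, ‖y‖ ≤ 2 * Real.pi ∧ torusProj y = x := by
  have h : ∀ i, ∃ y : ℝ, y ∈ Set.Ico (0 : ℝ) (0 + 2 * Real.pi) ∧
      (y : AddCircle (2 * Real.pi)) = x i := fun i => by
    have : x i ∈ ((↑) : ℝ → AddCircle (2 * Real.pi)) '' Set.Ico (0 : ℝ) (0 + 2 * Real.pi) := by
      rw [AddCircle.coe_image_Ico_eq]; trivial
    simpa using this
  choose y hy hyx using h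
  refine ⟨y, ?_, funext hyx⟩
  rw [pi_norm_le_iff_of_nonneg (by positivity)]
  intro i
  have := hy i
  rw [Real.norm_eq_abs, abs_le]
  constructor <;> linarith [this.1, this.2, Real.pi_pos]

/-- The pullback to `ℝ^d × ℝ^d` of a function on phase space. -/
def lift (b : Phase d → ℂ) (q : Rd d × Rd d) : ℂ := b (torusProj q.1, q.2)

/-- Smooth functions on phase space that vanish for large `ξ`. -/
structure IsSmoothSymbol (b : Phase d → ℂ) : Prop where
  smooth : ContDiff ℝ (⊤ : ℕ∞) (lift b)
  supp : ∃ R : ℝ, ∀ x ξ, R < ‖ξ‖ → b (x, ξ) = 0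

theorem IsSymbol.isSmoothSymbol {a : Phase d → ℂ} (ha : IsSymbol a) : IsSmoothSymbol a := by
  refine ⟨ha.2.2, ?_⟩
  have hc : IsCompact (Prod.snd '' tsupport a) := ha.2.1.isCompact.image continuous_snd
  obtain ⟨R, hR⟩ := hc.isBounded.exists_norm_le
  refine ⟨R, fun x ξ hξ => ?_⟩
  by_contra hne
  exact absurd (hR ξ ⟨(x, ξ), subset_tsupport _ hne, rfl⟩) (not_le.2 hξ)

theorem continuous_of_continuous_lift {b : Phase d → ℂ} (hb : Continuous (lift b)) :
    Continuous b :=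
  (isOpenQuotientMap_torusProj.prodMap IsOpenQuotientMap.id).isQuotientMap.continuous_iff.2 hb

theorem lift_fderiv_congr (b : Phase d → ℂ) {y y' : Rd d} (h : torusProj y = torusProj y')
    (ξ : Rd d) : fderiv ℝ (lift b) (y, ξ) = fderiv ℝ (lift b) (y', ξ) := by
  have h0 : torusProj (y' - y) = 0 := by
    have := torusProj_add y (y' - y)
    rw [add_sub_cancel, ← h] at this
    simpa using this
  have hper : (fun q : Rd d × Rd d => lift b (q + (y' - y, 0))) = lift b := by
    funext q
    simp [lift, torusProj_add, h0]
  have := fderiv_comp_add_right (𝕜 := ℝ) (f := lift b) (x := (y, ξ)) ((y' - y, 0) : Rd d × Rd d)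
  rw [hper] at this
  rw [this]
  simp

/-- The partial derivative in `x_i` of a function on phase space. -/
def xDeriv (i : Fin d) (b : Phase d → ℂ) (q : Phase d) : ℂ :=
  fderiv ℝ (lift b) ((exists_torusProj_eq q.1).choose, q.2) (Pi.single i 1, 0)

theorem lift_xDeriv (i : Fin d) (b : Phase d → ℂ) (q : Rd d × Rd d) :
    lift (xDeriv i b) q = fderiv ℝ (lift b) q (Pi.single i 1, 0) := by
  change fderiv ℝ (lift b) ((exists_torusProj_eq (torusProj q.1)).choose, q.2) _ = _
  rw [lift_fderiv_congr b (exists_torusProj_eq (torusProj q.1)).choose_spec.2]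

theorem IsSmoothSymbol.fderiv_lift_eq_zero {b : Phase d → ℂ} {R : ℝ}
    (hR : ∀ x ξ, R < ‖ξ‖ → b (x, ξ) = 0) (y : Rd d) {ξ : Rd d} (hξ : R < ‖ξ‖) :
    fderiv ℝ (lift b) (y, ξ) = 0 := by
  have : lift b =ᶠ[𝓝 (y, ξ)] fun _ => 0 := by
    have : {q : Rd d × Rd d | R < ‖q.2‖} ∈ 𝓝 (y, ξ) :=
      (isOpen_lt continuous_const (by fun_prop)).mem_nhds hξ
    filter_upwards [this] with q hq using hR _ _ hq
  rw [this.fderiv_eq]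
  simp

theorem IsSmoothSymbol.xDeriv {b : Phase d → ℂ} (hb : IsSmoothSymbol b) (i : Fin d) :
    IsSmoothSymbol (xDeriv i b) := by
  obtain ⟨R, hR⟩ := hb.supp
  refine ⟨?_, R, fun x ξ hξ => ?_⟩
  · rw [show lift (TorusSchrodinger.xDeriv i b) =
      fun q => fderiv ℝ (lift b) q (Pi.single i 1, 0) from funext (lift_xDeriv i b)]
    exact (hb.smooth.fderiv_right (m := (⊤ : ℕ∞)) (by simp)).clm_apply contDiff_const
  · simp only [TorusSchrodinger.xDeriv]
    rw [IsSmoothSymbol.fderiv_lift_eq_zero hR _ hξ]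
    simp

theorem IsSmoothSymbol.continuous {b : Phase d → ℂ} (hb : IsSmoothSymbol b) : Continuous b :=
  continuous_of_continuous_lift hb.smooth.continuous

theorem IsSmoothSymbol.continuous_left {b : Phase d → ℂ} (hb : IsSmoothSymbol b) (ξ : Rd d) :
    Continuous fun x => b (x, ξ) :=
  hb.continuous.comp (by fun_prop)

theorem IsSmoothSymbol.bounded {b : Phase d → ℂ} (hb : IsSmoothSymbol b) :
    ∃ B : ℝ, 0 ≤ B ∧ ∀ q, ‖b q‖ ≤ B := by
  obtain ⟨R, hR⟩ := hb.supp
  obtain ⟨B, hB⟩ := ((isCompact_univ (X := Td d)).prod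
    (isCompact_closedBall (0 : Rd d) R)).exists_bound_of_continuousOn hb.continuous.continuousOn
  refine ⟨max B 0, le_max_right _ _, fun q => ?_⟩
  rcases lt_or_ge R ‖q.2‖ with h | h
  · rw [show b q = 0 from hR q.1 q.2 h]; simp
  · exact (hB q ⟨trivial, by simpa using h⟩).trans (le_max_left _ _)

theorem IsSmoothSymbol.lipschitz {b : Phase d → ℂ} (hb : IsSmoothSymbol b) :
    ∃ L : ℝ, 0 ≤ L ∧ ∀ x ξ η, ‖b (x, ξ) - b (x, η)‖ ≤ L * ‖ξ - η‖ := by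
  obtain ⟨R, hR⟩ := hb.supp
  have hcont : Continuous (fderiv ℝ (lift b)) := hb.smooth.continuous_fderiv (by simp)
  obtain ⟨L, hL⟩ := ((isCompact_closedBall (0 : Rd d) (2 * Real.pi)).prod
    (isCompact_closedBall (0 : Rd d) R)).exists_bound_of_continuousOn hcont.continuousOn
  have hbd : ∀ y ξ, ‖y‖ ≤ 2 * Real.pi → ‖fderiv ℝ (lift b) (y, ξ)‖ ≤ max L 0 := by
    intro y ξ hy
    rcases lt_or_ge R ‖ξ‖ with h | h
    · rw [IsSmoothSymbol.fderiv_lift_eq_zero hR y h]; simp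
    · exact (hL (y, ξ) ⟨by simpa using hy, by simpa using h⟩).trans (le_max_left _ _)
  refine ⟨max L 0, le_max_right _ _, fun x ξ η => ?_⟩
  obtain ⟨y, hy, rfl⟩ := exists_torusProj_eq x
  have hconv : Convex ℝ ({y} ×ˢ Set.univ : Set (Rd d × Rd d)) :=
    (convex_singleton y).prod convex_univ
  have := hconv.norm_image_sub_le_of_norm_fderiv_le (𝕜 := ℝ) (f := lift b) (C := max L 0)
    (x := (y, η)) (y := (y, ξ))
    (fun q _ => (hb.smooth.differentiable (by simp)) q)
    (fun q hq => by
      obtain ⟨q1, q2⟩ := q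
      obtain rfl : q1 = y := hq.1
      exact hbd q1 q2 hy) (by simp) (by simp)
  simpa [lift, Prod.norm_def] using this

end SymbolClass

section Coefficients

theorem char_add (k : Zd d) (x y : Td d) : char k (x + y) = char k x * char k y := by
  simp [char, fourier_apply, smul_add, AddCircle.toCircle_add, Finset.prod_mul_distrib]

theorem norm_char (k : Zd d) (x : Td d) : ‖char k x‖ = 1 := by
  unfold char
  rw [norm_prod]
  exact Finset.prod_eq_one fun i _ => Circle.norm_coe _

theorem continuous_char (k : Zd d) : Continuous (char k) := by
  unfold char; fun_prop

theorem conj_char (k : Zd d) (x : Td d) : conj (char k x) = char (-k) x := by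
  simp [char]

theorem char_torusProj_single (k : Zd d) (i : Fin d) (s : ℝ) :
    char k (torusProj (s • Pi.single i 1)) = Complex.exp (Complex.I * k i * s) := by
  unfold char
  rw [Finset.prod_eq_single i]
  · simp only [torusProj, fourier_coe_apply]
    congr 1
    have : (Real.pi : ℂ) ≠ 0 := by exact_mod_cast Real.pi_ne_zero
    simp
    field_simp
  · intro j _ hj
    simp [torusProj, hj]
  · simp

theorem IsSmoothSymbol.integrable {b : Phase d → ℂ} (hb : IsSmoothSymbol b) (k : Zd d)
    (ξ : Rd d) : Integrable fun x : Td d => b (x, ξ) * conj (char k x) := by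
  have : Continuous fun x : Td d => b (x, ξ) * conj (char k x) :=
    (hb.continuous_left ξ).mul (Complex.continuous_conj.comp (continuous_char k))
  exact this.integrable_of_hasCompactSupport (HasCompactSupport.of_compactSpace _)

theorem IsSmoothSymbol.hasDerivAt_translate {b : Phase d → ℂ} (hb : IsSmoothSymbol b) (i : Fin d)
    (x : Td d) (ξ : Rd d) (s : ℝ) :
    HasDerivAt (fun s : ℝ => b (x + torusProj (s • Pi.single i 1), ξ))
      (TorusSchrodinger.xDeriv i b (x + torusProj (s • Pi.single i 1), ξ)) s := by
  obtain ⟨y, -, rfl⟩ := exists_torusProj_eq x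
  have h1 : HasDerivAt (fun s : ℝ => ((y + s • Pi.single i 1, ξ) : Rd d × Rd d))
      (Pi.single i 1, 0) s := by
    have : HasDerivAt (fun s : ℝ => y + s • (Pi.single i 1 : Rd d)) (Pi.single i 1) s := by
      simpa using ((hasDerivAt_id s).smul_const (Pi.single i 1 : Rd d)).const_add y
    exact this.prodMk (hasDerivAt_const s ξ)
  have h2 := ((hb.smooth.differentiable (by simp)) (y + s • Pi.single i 1, ξ)).hasFDerivAt
  have h3 := h2.comp_hasDerivAt s h1
  rw [← lift_xDeriv] at h3
  simpa [Function.comp_def, lift, torusProj_add] using h3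

theorem integral_translate_mul_conj_char (b : Phase d → ℂ) (i : Fin d) (k : Zd d) (ξ : Rd d)
    (s : ℝ) :
    ∫ x : Td d, b (x + torusProj (s • Pi.single i 1), ξ) * conj (char k x)
      = Complex.exp (Complex.I * k i * s) * ∫ x : Td d, b (x, ξ) * conj (char k x) := by
  rw [← char_torusProj_single, ← integral_const_mul]
  generalize torusProj (s • Pi.single i 1) = z
  rw [← integral_add_right_eq_self (fun x : Td d => char k z * (b (x, ξ) * conj (char k x))) z]
  congr 1
  funext x
  have h1 : char k z * conj (char k z) = 1 := by
    rw [Complex.mul_conj, Complex.normSq_eq_norm_sq, norm_char]; simp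
  rw [char_add, map_mul]
  linear_combination -(b (x + z, ξ) * conj (char k x)) * h1

theorem IsSmoothSymbol.continuous_translate {b : Phase d → ℂ} (hb : IsSmoothSymbol b)
    (z : Td d) (k : Zd d) (ξ : Rd d) :
    Continuous fun x : Td d => b (x + z, ξ) * conj (char k x) :=
  (hb.continuous.comp (by fun_prop)).mul (Complex.continuous_conj.comp (continuous_char k))

theorem IsSmoothSymbol.hasDerivAt_integral_translate {b : Phase d → ℂ} (hb : IsSmoothSymbol b)
    (i : Fin d) (k : Zd d) (ξ : Rd d) :
    HasDerivAt (fun s : ℝ =>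
        ∫ x : Td d, b (x + torusProj (s • Pi.single i 1), ξ) * conj (char k x))
      (∫ x : Td d, TorusSchrodinger.xDeriv i b (x, ξ) * conj (char k x)) 0 := by
  obtain ⟨B, hB0, hB⟩ := (hb.xDeriv i).bounded
  have hz : torusProj ((0 : ℝ) • (Pi.single i 1 : Rd d)) = 0 := by funext i; simp [torusProj]
  let F : ℝ → Td d → ℂ := fun s x =>
    b (x + torusProj (s • Pi.single i 1), ξ) * conj (char k x)
  let F' : ℝ → Td d → ℂ := fun s x =>
    TorusSchrodinger.xDeriv i b (x + torusProj (s • Pi.single i 1), ξ) * conj (char k x)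
  have hF : ∀ s, Continuous (F s) := fun s => hb.continuous_translate _ k ξ
  have hF' : ∀ s, Continuous (F' s) := fun s => (hb.xDeriv i).continuous_translate _ k ξ
  have hbound : ∀ x s, ‖F' s x‖ ≤ B := fun x s => by
    simp only [F']
    rw [norm_mul, RCLike.norm_conj, norm_char, mul_one]
    exact hB _
  have hdiff : ∀ x s, HasDerivAt (fun s => F s x) (F' s x) s := fun x s =>
    (hb.hasDerivAt_translate i x ξ s).mul_const _
  have h0 : F' 0 = fun x => TorusSchrodinger.xDeriv i b (x, ξ) * conj (char k x) := by
    funext x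
    simp only [F', hz, add_zero]
  have hint : Integrable (F 0) (volume : Measure (Td d)) :=
    (hF 0).integrable_of_hasCompactSupport (HasCompactSupport.of_compactSpace _)
  have hder := (hasDerivAt_integral_of_dominated_loc_of_deriv_le (𝕜 := ℝ)
    (μ := (volume : Measure (Td d)))
    (F := F) (F' := F') (x₀ := (0 : ℝ)) (s := Set.univ) (bound := fun _ => B) Filter.univ_mem
    (Eventually.of_forall fun s => (hF s).aestronglyMeasurable) hint
    (hF' 0).aestronglyMeasurable
    (Eventually.of_forall fun x s _ => hbound x s) (integrable_const B)
    (Eventually.of_forall fun x s _ => hdiff x s)).2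
  rw [h0] at hder
  exact hder

theorem symbCoeff_xDeriv {b : Phase d → ℂ} (hb : IsSmoothSymbol b) (i : Fin d) (k : Zd d)
    (ξ : Rd d) : symbCoeff (xDeriv i b) k ξ = Complex.I * k i * symbCoeff b k ξ := by
  unfold symbCoeff
  rw [mul_left_comm]
  congr 1
  have hder := hb.hasDerivAt_integral_translate i k ξ
  simp only [integral_translate_mul_conj_char] at hder
  refine hder.unique ?_
  have h1 : HasDerivAt (fun s : ℝ => Complex.I * k i * (s : ℂ)) (Complex.I * k i) 0 := by
    simpa using (Complex.ofRealCLM.hasDerivAt (x := (0 : ℝ))).const_mul (Complex.I * (k i : ℂ))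
  simpa using h1.cexp.mul_const (∫ x : Td d, b (x, ξ) * conj (char k x))

theorem IsSmoothSymbol.iterate_xDeriv {b : Phase d → ℂ} (hb : IsSmoothSymbol b) (i : Fin d)
    (n : ℕ) : IsSmoothSymbol ((TorusSchrodinger.xDeriv i)^[n] b) ∧ ∀ k ξ,
      symbCoeff ((TorusSchrodinger.xDeriv i)^[n] b) k ξ =
        (Complex.I * k i) ^ n * symbCoeff b k ξ := by
  induction n with
  | zero => exact ⟨hb, by simp⟩
  | succ n ih =>
    rw [Function.iterate_succ_apply']
    refine ⟨ih.1.xDeriv i, fun k ξ => ?_⟩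
    rw [symbCoeff_xDeriv ih.1, ih.2, pow_succ']
    ring

theorem norm_integral_mul_conj_char_le {f : Td d → ℂ} {B : ℝ} (hf : ∀ x, ‖f x‖ ≤ B) (k : Zd d) :
    ‖∫ x : Td d, f x * conj (char k x)‖ ≤ B * (volume : Measure (Td d)).real Set.univ :=
  norm_integral_le_of_norm_le_const (Eventually.of_forall fun x => by
    simpa [norm_char] using hf x)

theorem IsSmoothSymbol.exists_symbCoeff_bound {b : Phase d → ℂ} (hb : IsSmoothSymbol b) :
    ∃ B : ℝ, 0 ≤ B ∧ (∀ k ξ, ‖symbCoeff b k ξ‖ ≤ B) ∧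
      ∀ k ξ η, ‖symbCoeff b k ξ - symbCoeff b k η‖ ≤ B * ‖ξ - η‖ := by
  obtain ⟨B, hB0, hB⟩ := hb.bounded
  obtain ⟨L, hL0, hL⟩ := hb.lipschitz
  set c : ℝ := ‖((Real.sqrt ((2 * Real.pi) ^ d) : ℝ) : ℂ)⁻¹‖
  set V : ℝ := (volume : Measure (Td d)).real Set.univ
  have hc : 0 ≤ c := norm_nonneg _
  have hV : 0 ≤ V := measureReal_nonneg
  refine ⟨c * (B * V) + c * (L * V), by positivity, fun k ξ => ?_, fun k ξ η => ?_⟩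
  · have : ‖symbCoeff b k ξ‖ ≤ c * (B * V) := by
      rw [symbCoeff, norm_mul]
      gcongr
      exact norm_integral_mul_conj_char_le (fun x => hB _) k
    exact this.trans (le_add_of_nonneg_right (by positivity))
  · have : ‖symbCoeff b k ξ - symbCoeff b k η‖ ≤ c * (L * ‖ξ - η‖ * V) := by
      rw [symbCoeff, symbCoeff, ← mul_sub, norm_mul,
        ← integral_sub (hb.integrable k ξ) (hb.integrable k η)]
      gcongr
      simp_rw [← sub_mul]
      exact norm_integral_mul_conj_char_le (fun x => hL x ξ η) k
    calc _ ≤ c * (L * ‖ξ - η‖ * V) := this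
      _ = c * (L * V) * ‖ξ - η‖ := by ring
      _ ≤ _ := by
        gcongr
        exact le_add_of_nonneg_left (by positivity)

theorem summable_inv_norm_pow (d : ℕ) :
    ∃ n : ℕ, Summable fun k : Zd d => ‖k‖⁻¹ ^ n := by
  let L := Submodule.span ℤ (Set.range (Pi.basisFun ℝ (Fin d)))
  refine ⟨Module.finrank ℤ L + 1, ?_⟩
  have h := ZLattice.summable_norm_pow_inv L _ (Nat.lt_succ_self _)
  have hmem : ∀ k : Zd d, toRd k ∈ L := fun k => by
    rw [Module.Basis.mem_span_iff_repr_mem]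
    intro i
    exact ⟨k i, by simp [toRd]⟩
  have hinj : Function.Injective fun k : Zd d => (⟨toRd k, hmem k⟩ : L) := fun k l hkl => by
    funext i
    have := congrFun (congrArg Subtype.val hkl) i
    simpa [toRd] using this
  have := h.comp_injective hinj
  refine this.congr fun k => ?_
  have : ‖toRd k‖ = ‖k‖ := by
    simp [Pi.norm_def, toRd]
    congr
  simp [this]

theorem IsSmoothSymbol.exists_symbCoeff_decay {a : Phase d → ℂ} (ha : IsSmoothSymbol a)
    (ha0 : ∀ ξ : Rd d, symbCoeff a 0 ξ = 0) :
    ∃ g : Zd d → ℝ, (∀ k, 0 ≤ g k) ∧ Summable g ∧ (∀ k ξ, ‖symbCoeff a k ξ‖ ≤ g k) ∧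
      ∀ k ξ η, ‖symbCoeff a k ξ - symbCoeff a k η‖ ≤ g k * ‖ξ - η‖ := by
  obtain ⟨n, hn⟩ := summable_inv_norm_pow d
  choose B hB0 hB hB' using fun i => (ha.iterate_xDeriv i n).1.exists_symbCoeff_bound
  have key : ∀ {k : Zd d} {z : ℂ} {t : ℝ}, 0 ≤ t → k ≠ 0 →
      (∀ i, ‖(Complex.I * k i) ^ n * z‖ ≤ B i * t) → ‖z‖ ≤ (∑ i, B i) * ‖k‖⁻¹ ^ n * t := by
    intro k z t ht hk h
    have hpos : 0 < ‖k‖ := norm_pos_iff.2 hk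
    have : Nonempty (Fin d) := by
      obtain ⟨i, -⟩ := Function.ne_iff.1 hk
      exact ⟨i⟩
    obtain ⟨i, hmax⟩ := Finite.exists_max fun i => ‖k i‖
    have hi : ‖k‖ = ‖k i‖ :=
      le_antisymm ((pi_norm_le_iff_of_nonneg (norm_nonneg _)).2 hmax) (norm_le_pi_norm k i)
    have h1 := h i
    have h2 : ‖(Complex.I * k i) ^ n * z‖ = ‖k‖ ^ n * ‖z‖ := by
      rw [hi]; simp [Int.norm_eq_abs]
    rw [h2] at h1
    have h3 : ‖k‖ ^ n * ‖z‖ ≤ (∑ i, B i) * t := h1.trans (by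
      gcongr
      exact Finset.single_le_sum (fun j _ => hB0 j) (Finset.mem_univ i))
    rw [inv_pow, mul_right_comm, ← div_eq_mul_inv, le_div_iff₀ (by positivity)]
    linarith
  refine ⟨fun k => (∑ i, B i) * ‖k‖⁻¹ ^ n, fun k => ?_, hn.mul_left _, fun k ξ => ?_,
    fun k ξ η => ?_⟩
  · have := Finset.sum_nonneg fun i (_ : i ∈ Finset.univ) => hB0 i
    positivity
  all_goals
    by_cases hk : k = 0
    · subst hk
      have := Finset.sum_nonneg fun i (_ : i ∈ Finset.univ) => hB0 i
      simp only [ha0, sub_self, norm_zero]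
      positivity
  · change _ ≤ (∑ i, B i) * ‖k‖⁻¹ ^ n
    rw [← mul_one ((∑ i, B i) * ‖k‖⁻¹ ^ n)]
    refine key zero_le_one hk fun i => ?_
    rw [← (ha.iterate_xDeriv i n).2, mul_one]
    exact hB i k ξ
  · refine key (norm_nonneg _) hk fun i => ?_
    rw [mul_sub, ← (ha.iterate_xDeriv i n).2, ← (ha.iterate_xDeriv i n).2]
    exact hB' i k ξ η

end Coefficients

section ResonantDirections

theorem exists_first_ne_zero {p : Zd d} (hp : p ≠ 0) : ∃ i, p i ≠ 0 ∧ ∀ j < i, p j = 0 := by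
  obtain ⟨i, hi, hmin⟩ := wellFounded_lt.has_min {i : Fin d | p i ≠ 0} (Function.ne_iff.1 hp)
  exact ⟨i, hi, fun j hj => not_not.1 fun h => hmin j h hj⟩

theorem gcd_natAbs_smul (l : ℤ) (p : Zd d) :
    Finset.univ.gcd (fun i => ((l • p) i).natAbs) =
      l.natAbs * Finset.univ.gcd (fun i => (p i).natAbs) := by
  simp only [Pi.smul_apply, smul_eq_mul, Int.natAbs_mul]
  rw [Finset.gcd_mul_left]
  simp

theorem exists_resonantDir {k : Zd d} (hk : k ≠ 0) :
    ∃ (ω : ResonantDir d) (l : ℤ), k = l • ω.p := by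
  set g := Finset.univ.gcd (fun i => (k i).natAbs)
  have hg : g ≠ 0 := fun h => hk <| by
    rw [Finset.gcd_eq_zero_iff] at h
    funext i
    simpa using h i (Finset.mem_univ i)
  have hdvd : ∀ i, ∃ c : ℤ, k i = g * c := fun i =>
    Int.natCast_dvd.2 (Finset.gcd_dvd (f := fun i => (k i).natAbs) (Finset.mem_univ i))
  choose p hp using hdvd
  have hkp : k = (g : ℤ) • p := funext fun i => by simpa using hp i
  have hp0 : p ≠ 0 := by
    rintro rfl
    exact hk (by simpa using hkp)
  have hgcd : Finset.univ.gcd (fun i => (p i).natAbs) = 1 := by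
    have h1 := gcd_natAbs_smul (g : ℤ) p
    rw [← hkp] at h1
    exact Nat.eq_of_mul_eq_mul_left (Nat.pos_of_ne_zero hg) (by simpa [g] using h1.symm)
  obtain ⟨i, hi, hlt⟩ := exists_first_ne_zero hp0
  have hfirst : ∀ c : ℤ, 0 ≤ c * p i → ∀ j, (∀ m, m < j → (c • p) m = 0) → c ≠ 0 →
      0 ≤ (c • p) j := by
    intro c hc j hj hc0
    rcases lt_trichotomy j i with h | rfl | h
    · simp [hlt j h]
    · simpa using hc
    · have := hj i h
      simp [hc0, hi] at this
  rcases le_total 0 (p i) with h | h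
  · exact ⟨⟨p, hp0, hgcd, fun j hj => by
      simpa using hfirst 1 (by simpa using h) j (by simpa using hj) one_ne_zero⟩, g, hkp⟩
  · refine ⟨⟨-p, by simpa using hp0, by simpa using hgcd, fun j hj => by
      simpa using hfirst (-1) (by simpa using h) j (by simpa using hj) (by simp)⟩, -g, ?_⟩
    simpa using hkp

theorem ResonantDir.ext_p {ω ω' : ResonantDir d} (h : ω.p = ω'.p) : ω = ω' := by
  cases ω; cases ω'; simp_all

theorem resonantDir_unique {k : Zd d} (hk : k ≠ 0) {ω ω' : ResonantDir d} {l l' : ℤ}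
    (h : k = l • ω.p) (h' : k = l' • ω'.p) : ω = ω' := by
  have hl : l ≠ 0 := by rintro rfl; exact hk (by simpa using h)
  have habs : l.natAbs = l'.natAbs := by
    have h1 := gcd_natAbs_smul l ω.p
    have h2 := gcd_natAbs_smul l' ω'.p
    rw [← h, ω.gcd_one, mul_one] at h1
    rw [← h', ω'.gcd_one, mul_one] at h2
    exact h1.symm.trans h2
  refine ResonantDir.ext_p ?_
  rcases Int.natAbs_eq_natAbs_iff.1 habs with rfl | rfl
  · exact smul_right_injective _ hl (h.symm.trans h')
  · exfalso
    have hneg : ω'.p = -ω.p := by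
      have hl' : l' ≠ 0 := by simpa using hl
      refine smul_right_injective _ hl' ?_
      change l' • ω'.p = l' • -ω.p
      rw [← h', h]; simp
    obtain ⟨i, hi, hlt⟩ := exists_first_ne_zero ω.ne
    have h1 := ω.first_pos i hlt
    have h2 := ω'.first_pos i fun j hj => by simp [hneg, hlt j hj]
    rw [hneg] at h2
    simp only [Pi.neg_apply] at h2
    omega

theorem ResonantDir.M_pos (ω : ResonantDir d) : 0 < ω.M := by
  obtain ⟨i, hi⟩ := Function.ne_iff.1 ω.ne
  exact Finset.sum_pos' (fun j _ => mul_self_nonneg _) ⟨i, Finset.mem_univ i, mul_self_pos.2 hi⟩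

theorem ResonantDir.norm_toRd_le (ω : ResonantDir d) : ‖toRd ω.p‖ ≤ ω.M := by
  rw [pi_norm_le_iff_of_nonneg (by exact_mod_cast ω.M_pos.le)]
  intro i
  have h1 : |ω.p i| ≤ ω.p i * ω.p i := by
    rw [← abs_mul_abs_self]
    rcases (abs_nonneg (ω.p i)).eq_or_lt with h | h <;> nlinarith
  have h2 : ω.p i * ω.p i ≤ ω.M :=
    Finset.single_le_sum (f := fun i => ω.p i * ω.p i) (fun j _ => mul_self_nonneg _)
      (Finset.mem_univ i)
  simp only [toRd, Real.norm_eq_abs]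
  exact_mod_cast h1.trans h2

theorem dotZ_sub_left (k l m : Zd d) : dotZ (k - l) m = dotZ k m - dotZ l m := by
  simp [dotZ, sub_mul]

theorem dotZ_smul_left (c : ℤ) (k m : Zd d) : dotZ (c • k) m = c * dotZ k m := by
  simp [dotZ, Finset.mul_sum, mul_assoc]

theorem dotZ_comm (k l : Zd d) : dotZ k l = dotZ l k := by
  simp [dotZ, mul_comm]

theorem dotZ_sub_dotZ {ω : ResonantDir d} {k j : Zd d} {l : ℤ} (h : k - j = l • ω.p) :
    dotZ k ω.p - dotZ j ω.p = l * ω.M := by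
  rw [← dotZ_sub_left, h, dotZ_smul_left]; rfl

theorem dotZ_self_sub {ω : ResonantDir d} {k j : Zd d} {l : ℤ} (h : k - j = l • ω.p) :
    dotZ k k - dotZ j j = l * (dotZ k ω.p + dotZ j ω.p) := by
  have h1 : dotZ k k - dotZ j k = l * dotZ k ω.p := by
    rw [← dotZ_sub_left, h, dotZ_smul_left, dotZ_comm]
  have h2 : dotZ k j - dotZ j j = l * dotZ j ω.p := by
    rw [← dotZ_sub_left, h, dotZ_smul_left, dotZ_comm]
  rw [dotZ_comm j k] at h1
  linear_combination h1 + h2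

theorem midpoint_sub_projPerp {ω : ResonantDir d} {k j : Zd d} {l : ℤ} (h : k - j = l • ω.p)
    (s : ℝ) :
    (s / 2) • (toRd k + toRd j) - s • projPerp ω k =
      (s * (((dotZ k ω.p + dotZ j ω.p : ℤ) : ℝ) / (2 * ω.M))) • toRd ω.p := by
  have hM : (ω.M : ℝ) ≠ 0 := by exact_mod_cast ω.M_pos.ne'
  have h1 : ((dotZ k ω.p : ℤ) : ℝ) - dotZ j ω.p = l * ω.M := by exact_mod_cast dotZ_sub_dotZ h
  funext i
  have h2 : (k i : ℝ) - j i = l * ω.p i := by exact_mod_cast congrFun h i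
  simp only [projPerp, toRd, Pi.sub_apply, Pi.smul_apply, Pi.add_apply, smul_eq_mul, Int.cast_add]
  field_simp
  linear_combination (-(s * ω.M : ℝ)) * h2 + (s * ω.p i : ℝ) * h1

theorem norm_midpoint_sub_projPerp_le {ω : ResonantDir d} {k j : Zd d} {l : ℤ}
    (h : k - j = l • ω.p) (hkj : k ≠ j) {s : ℝ} (hs : 0 ≤ s) :
    ‖(s / 2) • (toRd k + toRd j) - s • projPerp ω k‖ ≤
      s * |((dotZ k k - dotZ j j : ℤ) : ℝ) / 2| := by
  have hl : l ≠ 0 := by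
    rintro rfl
    exact hkj (sub_eq_zero.1 (by simpa using h))
  have hM : (0 : ℝ) < ω.M := by exact_mod_cast ω.M_pos
  have hl1 : (1 : ℝ) ≤ |(l : ℝ)| := by exact_mod_cast Int.one_le_abs hl
  rw [midpoint_sub_projPerp h, dotZ_self_sub h, norm_smul, Real.norm_eq_abs, abs_mul,
    abs_of_nonneg hs, mul_assoc]
  gcongr
  set t : ℝ := ((dotZ k ω.p + dotZ j ω.p : ℤ) : ℝ)
  calc |t / (2 * ω.M)| * ‖toRd ω.p‖ ≤ |t / (2 * ω.M)| * ω.M := by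
        gcongr; exact ω.norm_toRd_le
    _ = 1 * |t / 2| := by
        rw [abs_div, abs_div, abs_mul, abs_of_pos hM]
        field_simp
    _ ≤ |(l : ℝ)| * |t / 2| := by gcongr
    _ = _ := by rw [← abs_mul, Int.cast_mul, mul_div_assoc]

end ResonantDirections

section FourierTransform

theorem exists_phiHat_bound (φ : SchwartzMap ℝ ℂ) :
    ∃ C : ℝ, 0 ≤ C ∧ (∀ s, ‖phiHat (fun t => φ t) s‖ ≤ C) ∧
      ∀ s, |s| * ‖phiHat (fun t => φ t) s‖ ≤ C := by
  have hF : ∀ s, phiHat (fun t => φ t) s =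
      FourierTransform.fourier φ (s / (2 * Real.pi)) := fun s => by
    rw [SchwartzMap.fourier_coe, Real.fourier_eq']
    refine integral_congr_ae (Eventually.of_forall fun t => ?_)
    simp only [smul_eq_mul]
    rw [mul_comm]
    congr 2
    have : (Real.pi : ℂ) ≠ 0 := by exact_mod_cast Real.pi_ne_zero
    simp
    field_simp
  obtain ⟨C0, hC0, h0⟩ := (FourierTransform.fourier φ : SchwartzMap ℝ ℂ).decay 0 0
  obtain ⟨C1, hC1, h1⟩ := (FourierTransform.fourier φ : SchwartzMap ℝ ℂ).decay 1 0
  refine ⟨C0 + 2 * Real.pi * C1, by positivity, fun s => ?_, fun s => ?_⟩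
  · have := h0 (s / (2 * Real.pi))
    rw [hF]
    simp only [pow_zero, one_mul, norm_iteratedFDeriv_zero] at this
    exact this.trans (le_add_of_nonneg_right (by positivity))
  · have := h1 (s / (2 * Real.pi))
    rw [hF]
    simp only [pow_one, norm_iteratedFDeriv_zero, Real.norm_eq_abs, abs_div,
      abs_of_pos Real.two_pi_pos] at this
    rw [div_mul_eq_mul_div, div_le_iff₀ Real.two_pi_pos] at this
    linarith

end FourierTransform

section QuadraticSums

theorem summable_mul_mul_convolution {u : Zd d → ℂ} (hu : Summable fun k => ‖u k‖ ^ 2)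
    {g : Zd d → ℝ} (hg0 : ∀ k, 0 ≤ g k) (hg : Summable g) :
    (Summable fun q : Zd d × Zd d => ‖u q.1‖ * ‖u q.2‖ * g (q.2 - q.1)) ∧
      ∑' q : Zd d × Zd d, ‖u q.1‖ * ‖u q.2‖ * g (q.2 - q.1) ≤
        (∑' k, ‖u k‖ ^ 2) * ∑' k, g k := by
  have hprod : HasSum (fun q : Zd d × Zd d => ‖u q.1‖ ^ 2 * g q.2)
      ((∑' k, ‖u k‖ ^ 2) * ∑' k, g k) :=
    hu.hasSum.mul hg.hasSum
      (hu.mul_of_nonneg hg (fun _ => by positivity) hg0)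
  let e₁ : Zd d × Zd d ≃ Zd d × Zd d :=
    { toFun := fun q => (q.1, q.2 - q.1)
      invFun := fun q => (q.1, q.2 + q.1)
      left_inv := fun q => by simp
      right_inv := fun q => by simp }
  let e₂ : Zd d × Zd d ≃ Zd d × Zd d :=
    { toFun := fun q => (q.2, q.2 - q.1)
      invFun := fun q => (q.1 - q.2, q.1)
      left_inv := fun q => by simp
      right_inv := fun q => by simp }
  have h1 := (e₁.hasSum_iff.2 hprod).mul_left (1 / 2)
  have h2 := (e₂.hasSum_iff.2 hprod).mul_left (1 / 2)
  have h12 := h1.add h2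
  have hle : ∀ q : Zd d × Zd d, ‖u q.1‖ * ‖u q.2‖ * g (q.2 - q.1) ≤
      1 / 2 * (‖u q.1‖ ^ 2 * g (q.2 - q.1)) + 1 / 2 * (‖u q.2‖ ^ 2 * g (q.2 - q.1)) := fun q => by
    have := mul_nonneg (hg0 (q.2 - q.1)) (sq_nonneg (‖u q.1‖ - ‖u q.2‖))
    linarith
  have hsum : Summable fun q : Zd d × Zd d => ‖u q.1‖ * ‖u q.2‖ * g (q.2 - q.1) :=
    Summable.of_nonneg_of_le (fun q => mul_nonneg (by positivity) (hg0 _)) hle h12.summable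
  refine ⟨hsum, (hsum.hasSum.tsum_eq.le).trans ?_⟩
  have := hasSum_le hle hsum.hasSum h12
  linarith

end QuadraticSums

section MainEstimate

/-- Half the difference of the Laplace eigenvalues of a pair of frequencies. -/
def energyGap (q : Zd d × Zd d) : ℝ := ((dotZ q.1 q.1 - dotZ q.2 q.2 : ℤ) : ℝ) / 2

/-- The normalising constant `(2π)^{-d/2}`. -/
def normConst (d : ℕ) : ℂ := ((Real.sqrt ((2 * Real.pi) ^ d) : ℝ) : ℂ)⁻¹

/-- The contribution of a pair of frequencies to the time-averaged Wigner distribution, with the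
symbol evaluated at `ξ`. -/
def pairTerm (a : Phase d → ℂ) (φ : ℝ → ℂ) (u : Zd d → ℂ) (q : Zd d × Zd d) (ξ : Rd d) : ℂ :=
  u q.1 * conj (u q.2) * (normConst d * phiHat φ (energyGap q) * symbCoeff a (q.2 - q.1) ξ)

theorem wignerPair_eq (u : Zd d → ℂ) (h : ℝ) (a : Phase d → ℂ) :
    wignerPair u h a = ∑' q : Zd d × Zd d, u q.1 * conj (u q.2) *
      (normConst d * symbCoeff a (q.2 - q.1) ((h / 2) • (toRd q.1 + toRd q.2))) := by
  rw [wignerPair, ← tsum_mul_left]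
  refine tsum_congr fun q => ?_
  have hK : normConst d * normConst d = (((2 * Real.pi) ^ d : ℝ) : ℂ)⁻¹ := by
    rw [normConst, ← mul_inv, ← Complex.ofReal_mul, Real.mul_self_sqrt (by positivity)]
  rw [symbCoeff, ← hK]
  simp only [conj_char, neg_sub]
  rw [← normConst]
  ring

theorem schrodinger_mul_conj (t : ℝ) (u : Zd d → ℂ) (q : Zd d × Zd d) :
    schrodinger t u q.1 * conj (schrodinger t u q.2) =
      Complex.exp (-Complex.I * (t : ℂ) * (energyGap q : ℂ)) * (u q.1 * conj (u q.2)) := by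
  have hsq : ∀ k : Zd d, (∑ i, ((k i : ℝ)) ^ 2) = ((dotZ k k : ℤ) : ℝ) := fun k => by
    simp [dotZ, sq]
  have hexp : Complex.exp (-Complex.I * (t : ℂ) * (energyGap q : ℂ)) =
      Complex.exp (-Complex.I * t * ((dotZ q.1 q.1 : ℤ) : ℂ) / 2) *
        conj (Complex.exp (-Complex.I * t * ((dotZ q.2 q.2 : ℤ) : ℂ) / 2)) := by
    rw [← Complex.exp_conj, ← Complex.exp_add]
    congr 1
    simp [energyGap, map_ofNat]
    ring
  simp only [schrodinger, hsq, map_mul, Complex.ofReal_intCast]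
  rw [hexp]
  ring

theorem integral_wignerPair {a : Phase d → ℂ} {φ : ℝ → ℂ} (hφ : Integrable φ) {u : Zd d → ℂ}
    {h : ℝ} (hs : Summable fun q : Zd d × Zd d => ‖u q.1 * conj (u q.2) *
      (normConst d * symbCoeff a (q.2 - q.1) ((h / 2) • (toRd q.1 + toRd q.2)))‖) :
    ∫ t : ℝ, φ t * wignerPair (schrodinger t u) h a =
      ∑' q : Zd d × Zd d, pairTerm a φ u q ((h / 2) • (toRd q.1 + toRd q.2)) := by
  set c : Zd d × Zd d → ℂ := fun q => u q.1 * conj (u q.2) *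
    (normConst d * symbCoeff a (q.2 - q.1) ((h / 2) • (toRd q.1 + toRd q.2)))
  let F : Zd d × Zd d → ℝ → ℂ := fun q t =>
    φ t * Complex.exp (-Complex.I * (t : ℂ) * (energyGap q : ℂ)) * c q
  have hexp : ∀ (q : Zd d × Zd d) (t : ℝ),
      ‖Complex.exp (-Complex.I * (t : ℂ) * (energyGap q : ℂ))‖ = 1 := fun q t => by
    rw [Complex.norm_exp]; simp
  have hFn : ∀ q t, ‖F q t‖ = ‖φ t‖ * ‖c q‖ := fun q t => by
    simp only [F, norm_mul, hexp, mul_one]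
  have hFint : ∀ q, Integrable (F q) := fun q => by
    refine (hφ.mul_bdd (c := 1) ?_ (Eventually.of_forall fun t => (hexp q t).le)).mul_const _
    exact Continuous.aestronglyMeasurable (by fun_prop)
  have hFsum : Summable fun q => ∫ t, ‖F q t‖ := by
    simp only [hFn, integral_mul_const]
    exact hs.mul_left _
  have key := hasSum_integral_of_summable_integral_norm hFint hFsum
  have h1 : ∀ t, ∑' q, F q t = φ t * wignerPair (schrodinger t u) h a := fun t => by
    rw [wignerPair_eq, ← tsum_mul_left]
    refine tsum_congr fun q => ?_
    rw [schrodinger_mul_conj]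
    simp only [F, c]
    ring
  simp only [h1] at key
  rw [← key.tsum_eq]
  refine tsum_congr fun q => ?_
  simp only [F, integral_mul_const, pairTerm]
  rw [← phiHat]
  simp only [c]
  ring

/-- Pairs of distinct frequencies. -/
abbrev OffDiag (d : ℕ) := {q : Zd d × Zd d // q.1 ≠ q.2}

/-- Pairs of frequencies whose difference is a multiple of `p_ω`. -/
abbrev ResPairs (ω : ResonantDir d) := {q : Zd d × Zd d // ∃ l : ℤ, q.1 - q.2 = l • ω.p}

/-- The resonant direction of the difference of two distinct frequencies. -/
def OffDiag.dir (q : OffDiag d) : ResonantDir d :=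
  (exists_resonantDir (sub_ne_zero.2 q.2)).choose

theorem OffDiag.dir_spec (q : OffDiag d) : ∃ l : ℤ, q.1.1 - q.1.2 = l • q.dir.p :=
  (exists_resonantDir (sub_ne_zero.2 q.2)).choose_spec

/-- A pair of distinct frequencies together with its resonant direction. -/
def OffDiag.toSigma (q : OffDiag d) : Σ ω : ResonantDir d, ResPairs ω :=
  ⟨q.dir, q.1, q.dir_spec⟩

theorem OffDiag.toSigma_injective : Function.Injective (OffDiag.toSigma (d := d)) := by
  intro q q' h
  exact Subtype.ext (congrArg (fun s : Σ ω : ResonantDir d, ResPairs ω => s.2.1) h)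

theorem OffDiag.mem_range_toSigma (s : Σ ω : ResonantDir d, ResPairs ω) (hs : s.2.1.1 ≠ s.2.1.2) :
    s ∈ Set.range (OffDiag.toSigma (d := d)) := by
  obtain ⟨ω, q, l, hl⟩ := s
  change q.1 ≠ q.2 at hs
  let q' : OffDiag d := ⟨q, hs⟩
  obtain ⟨l', hl'⟩ := q'.dir_spec
  obtain rfl : q'.dir = ω := resonantDir_unique (sub_ne_zero.2 hs) hl' hl
  exact ⟨q', rfl⟩

theorem kerKaphi_dotZ (a : Phase d → ℂ) (φ : ℝ → ℂ) {ω : ResonantDir d} {k j : Zd d}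
    (h : ∃ l : ℤ, k - j = l • ω.p) (ξ : Rd d) :
    kerKaphi a φ ω ξ (dotZ j ω.p) (dotZ k ω.p) =
      if k = j then 0 else
        normConst d * phiHat φ (energyGap (k, j)) * symbCoeff a (j - k) ξ := by
  obtain ⟨l, hl⟩ := h
  have hM := ω.M_pos
  have h1 := dotZ_sub_dotZ hl
  have h2 := dotZ_self_sub hl
  by_cases hkj : k = j
  · subst hkj
    simp [kerKaphi]
  have hl0 : l ≠ 0 := by
    rintro rfl
    exact hkj (sub_eq_zero.1 (by simpa using hl))
  have hne : dotZ j ω.p ≠ dotZ k ω.p := fun h => by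
    rw [h, sub_self] at h1
    exact mul_ne_zero hl0 hM.ne' h1.symm
  have h3 : dotZ j ω.p - dotZ k ω.p = ω.M * (-l) := by linear_combination -h1
  rw [kerKaphi, if_pos ⟨hne, Dvd.intro _ h3.symm⟩, if_neg hkj, ← normConst, h3,
    Int.mul_ediv_cancel_left _ hM.ne', neg_smul, ← hl, neg_sub]
  congr 3
  have hMR : (ω.M : ℝ) ≠ 0 := by exact_mod_cast hM.ne'
  have h4 : dotZ k ω.p ^ 2 - dotZ j ω.p ^ 2 = (dotZ k k - dotZ j j) * ω.M := by
    rw [h2]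
    linear_combination (dotZ k ω.p + dotZ j ω.p) * h1
  rw [h4, energyGap]
  push_cast
  field_simp

theorem tsum_resPair_eq {a : Phase d → ℂ} {φ : ℝ → ℂ} {u : Zd d → ℂ} {h : ℝ}
    (hs : Summable fun q : OffDiag d => pairTerm a φ u q.1 (h • projPerp q.dir q.1.1)) :
    ∑' ω : ResonantDir d, resPair u h ω (fun ξ => kerKaphi a φ ω ξ) =
      ∑' q : OffDiag d, pairTerm a φ u q.1 (h • projPerp q.dir q.1.1) := by
  let H : (Σ ω : ResonantDir d, ResPairs ω) → ℂ := fun s =>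
    u s.2.1.1 * conj (u s.2.1.2) * kerKaphi a φ s.1 (h • projPerp s.1 s.2.1.1)
      (dotZ s.2.1.2 s.1.p) (dotZ s.2.1.1 s.1.p)
  have hH : ∀ q : OffDiag d, H q.toSigma = pairTerm a φ u q.1 (h • projPerp q.dir q.1.1) :=
    fun q => by
      simp only [H, OffDiag.toSigma, pairTerm]
      rw [kerKaphi_dotZ a φ q.dir_spec, if_neg q.2]
  have hsupp : ∀ s, s ∉ Set.range (OffDiag.toSigma (d := d)) → H s = 0 := fun s hsr => by
    have heq : s.2.1.1 = s.2.1.2 := by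
      by_contra hne
      exact hsr (OffDiag.mem_range_toSigma s hne)
    simp only [H]
    rw [kerKaphi_dotZ a φ s.2.2, if_pos heq, mul_zero]
  have hsum : Summable H := by
    rw [← OffDiag.toSigma_injective.summable_iff hsupp]
    exact hs.congr fun q => (hH q).symm
  have h1 : ∑' ω : ResonantDir d, resPair u h ω (fun ξ => kerKaphi a φ ω ξ) = ∑' s, H s :=
    hsum.tsum_sigma.symm
  rw [h1, ← OffDiag.toSigma_injective.tsum_eq fun s hs' => by
    by_contra hsr
    exact hs' (hsupp s hsr)]
  exact tsum_congr hH

end MainEstimate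

/-- Lemma 2: for a symbol `a ∈ C_c^∞(T^*𝕋^d)` with
`∫_{𝕋^d} a(x,·) dx = 0` (i.e. `a_0 ≡ 0`) and `φ ∈ 𝒮(ℝ)`, there is `C_{a,φ} > 0`
such that for every `u ∈ L²(𝕋^d)` and `h > 0`,
`|∫ φ(t) ⟨w_u^h(t,·), a⟩ dt − ∑_{ω∈𝕎} tr ∫_{I_ω} k_{a,φ}(ω,ξ) R_u^h(ω,dξ)|
  ≤ C_{a,φ} ‖u‖²_{L²} h`. -/
theorem statement15 {d : ℕ} (a : Phase d → ℂ) (ha : IsSymbol a)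
    (ha0 : ∀ ξ : Rd d, symbCoeff a 0 ξ = 0) (φ : SchwartzMap ℝ ℂ) :
    ∃ C : ℝ, 0 < C ∧
      ∀ u : Zd d → ℂ, (Summable fun k => ‖u k‖ ^ 2) → ∀ h : ℝ, 0 < h →
        ‖(∫ t : ℝ, φ t * wignerPair (schrodinger t u) h a) -
            ∑' ω : ResonantDir d, resPair u h ω (fun ξ => kerKaphi a (fun s => φ s) ω ξ)‖
          ≤ C * (∑' k, ‖u k‖ ^ 2) * h := by
  obtain ⟨g, hg0, hgs, hgb, hgl⟩ := ha.isSmoothSymbol.exists_symbCoeff_decay ha0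
  obtain ⟨B, hB0, hB, hB'⟩ := exists_phiHat_bound φ
  set K : ℝ := ‖normConst d‖
  have hK0 : 0 ≤ K := norm_nonneg _
  have hG0 : 0 ≤ ∑' k, g k := tsum_nonneg hg0
  refine ⟨K * B * ∑' k, g k + 1, by positivity, fun u hu h hh => ?_⟩
  obtain ⟨hws, hwle⟩ := summable_mul_mul_convolution hu hg0 hgs
  set w : Zd d × Zd d → ℝ := fun q => ‖u q.1‖ * ‖u q.2‖ * g (q.2 - q.1)
  have hterm : ∀ q ξ, ‖pairTerm a (fun s => φ s) u q ξ‖ ≤ K * B * w q := fun q ξ => by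
    simp only [pairTerm, norm_mul, RCLike.norm_conj]
    calc _ ≤ ‖u q.1‖ * ‖u q.2‖ * (K * B * g (q.2 - q.1)) := by
          gcongr
          · exact hB _
          · exact hgb _ _
      _ = _ := by ring
  have hsum : ∀ ξ : OffDiag d → Rd d,
      Summable fun q : OffDiag d => pairTerm a (fun s => φ s) u q.1 (ξ q) := fun ξ =>
    Summable.of_norm_bounded ((hws.mul_left (K * B)).comp_injective Subtype.val_injective)
      fun q => hterm q.1 _
  have hint := integral_wignerPair (a := a) (φ := fun s => φ s) φ.integrable (u := u) (h := h) <| by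
    refine Summable.of_nonneg_of_le (fun _ => norm_nonneg _) (fun q => ?_) (hws.mul_left K)
    simp only [norm_mul, RCLike.norm_conj]
    calc _ ≤ ‖u q.1‖ * ‖u q.2‖ * (K * g (q.2 - q.1)) := by
          gcongr
          exact hgb _ _
      _ = _ := by ring
  have hoff : ∑' q : OffDiag d,
      pairTerm a (fun s => φ s) u q.1 ((h / 2) • (toRd q.1.1 + toRd q.1.2)) =
      ∑' q, pairTerm a (fun s => φ s) u q ((h / 2) • (toRd q.1 + toRd q.2)) := by
    refine Function.Injective.tsum_eq (g := (Subtype.val : OffDiag d → Zd d × Zd d))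
      (f := fun q => pairTerm a (fun s => φ s) u q ((h / 2) • (toRd q.1 + toRd q.2)))
      Subtype.val_injective fun q hq => ?_
    by_contra hne
    refine hq ?_
    have : q.1 = q.2 := by
      by_contra h'
      exact hne ⟨⟨q, h'⟩, rfl⟩
    simp [pairTerm, this, ha0]
  rw [hint, tsum_resPair_eq (hsum _), ← hoff, ← (hsum _).tsum_sub (hsum _)]
  have hdiff : ∀ q : OffDiag d,
      ‖pairTerm a (fun s => φ s) u q.1 ((h / 2) • (toRd q.1.1 + toRd q.1.2)) -
        pairTerm a (fun s => φ s) u q.1 (h • projPerp q.dir q.1.1)‖ ≤ K * B * h * w q.1 := by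
    intro q
    obtain ⟨l, hl⟩ := q.dir_spec
    have h1 := (hgl (q.1.2 - q.1.1) _ _).trans (mul_le_mul_of_nonneg_left
      (norm_midpoint_sub_projPerp_le hl q.2 hh.le) (hg0 _))
    have h2 := hB' (energyGap q.1)
    simp only [pairTerm, ← mul_sub]
    simp only [norm_mul, RCLike.norm_conj]
    calc _ ≤ ‖u q.1.1‖ * ‖u q.1.2‖ * (K * ‖phiHat (fun s => φ s) (energyGap q.1)‖ *
          (g (q.1.2 - q.1.1) * (h * |energyGap q.1|))) := by
          gcongr
          exact h1
      _ = K * h * w q.1 * (|energyGap q.1| * ‖phiHat (fun s => φ s) (energyGap q.1)‖) := by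
          simp only [w]; ring
      _ ≤ K * h * w q.1 * B := by
          have : 0 ≤ w q.1 := mul_nonneg (by positivity) (hg0 _)
          gcongr
      _ = _ := by ring
  have hwoff : ∑' q : OffDiag d, w q.1 ≤ ∑' q, w q :=
    hws.tsum_subtype_le w _ fun q => mul_nonneg (by positivity) (hg0 _)
  calc _ ≤ ∑' q : OffDiag d, K * B * h * w q.1 :=
        tsum_of_norm_bounded
          ((hws.comp_injective Subtype.val_injective).mul_left (K * B * h)).hasSum hdiff
    _ = K * B * h * ∑' q : OffDiag d, w q.1 := tsum_mul_left
    _ ≤ K * B * h * ((∑' k, ‖u k‖ ^ 2) * ∑' k, g k) := by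
        gcongr
        exact hwoff.trans hwle
    _ = K * B * (∑' k, g k) * (∑' k, ‖u k‖ ^ 2) * h := by ring
    _ ≤ _ := by
        have : 0 ≤ ∑' k, ‖u k‖ ^ 2 := tsum_nonneg fun _ => by positivity
        gcongr
        linarith

end TorusSchrodinger
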